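/- A normed linear space X over the field K (real or complex) is strictly convex if and only if for each x ∈ X with ‖x‖ = 1 there exists a Hamel basis of X containing x which is strongly orthonormal relative to x in the sense of Birkhoff–James. -/

import Mathlib

open scoped BigOperators

/-- `B` is a Hamel basis of the `𝕜`-vector space `X`. -/
def IsHamelBasis (𝕜 : Type*) [DivisionRing 𝕜] {X : Type*} [AddCommGroup X] [Module 𝕜 X]
    (B : Set X) : Prop :=
  LinearIndependent 𝕜 ((↑) : B → X) ∧ Submodule.span 𝕜 B = ⊤

/-- The set `B` is strongly orthonormal relative to `x₀` in the sense of Birkhoff–James: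
every element of `B` has norm one, and for every finite subset of `B \ {x₀}` and scalars
not all zero, `‖x₀ + ∑ λⱼ xⱼ‖ > ‖x₀‖`. -/
def IsStronglyOrthonormalRelTo (𝕜 : Type*) [RCLike 𝕜] {X : Type*} [NormedAddCommGroup X]
    [NormedSpace 𝕜 X] (B : Set X) (x₀ : X) : Prop :=
  (∀ y ∈ B, ‖y‖ = 1) ∧
  ∀ (s : Finset X) (c : X → 𝕜), (s : Set X) ⊆ B \ {x₀} → (∃ y ∈ s, c y ≠ 0) →
    ‖x₀‖ < ‖x₀ + ∑ y ∈ s, c y • y‖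

/-- `x₀` is an extreme point of the closed unit ball of `X`. -/
def IsExtremePointOfBall (𝕜 : Type*) [RCLike 𝕜] {X : Type*} [NormedAddCommGroup X]
    [NormedSpace 𝕜 X] (x₀ : X) : Prop :=
  ‖x₀‖ ≤ 1 ∧ ∀ z₁ z₂ : X, ‖z₁‖ ≤ 1 → ‖z₂‖ ≤ 1 → ∀ t : ℝ, 0 < t → t < 1 →
    x₀ = ((t : 𝕜) • z₁ + (((1 - t : ℝ) : 𝕜)) • z₂) → z₁ = x₀ ∧ z₂ = x₀

/-- `x₀` is an exposed point of the closed unit ball of `X`: there is a supporting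
hyperplane `H = {z : f z = 1}` (with `f` a norm-one continuous linear functional and
`f x₀ = 1`) meeting the ball only at `x₀`. -/
def IsExposedPointOfBall (𝕜 : Type*) [RCLike 𝕜] {X : Type*} [NormedAddCommGroup X]
    [NormedSpace 𝕜 X] (x₀ : X) : Prop :=
  ‖x₀‖ ≤ 1 ∧ ∃ f : X →L[𝕜] 𝕜, ‖f‖ = 1 ∧ f x₀ = 1 ∧ ∀ z : X, ‖z‖ ≤ 1 → f z = 1 → z = x₀

/-- `X` is strictly convex: every element of the unit sphere is an extreme point of the
closed unit ball. -/
def IsStrictlyConvexSpace (𝕜 : Type*) [RCLike 𝕜] (X : Type*) [NormedAddCommGroup X]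
    [NormedSpace 𝕜 X] : Prop :=
  ∀ x : X, ‖x‖ = 1 → IsExtremePointOfBall 𝕜 x

theorem IsExposedPointOfBall.isExtremePointOfBall {𝕜 X : Type*} [RCLike 𝕜]
    [NormedAddCommGroup X] [NormedSpace 𝕜 X] {x : X} (h : IsExposedPointOfBall 𝕜 x) :
    IsExtremePointOfBall 𝕜 x := by
  obtain ⟨hx, f, hf, hfx, huniq⟩ := h
  refine ⟨hx, fun z₁ z₂ h₁ h₂ t ht₀ ht₁ hxz ↦ ?_⟩
  have hle : ∀ z : X, ‖z‖ ≤ 1 → ‖f z‖ ≤ 1 := fun z hz ↦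
    (f.le_opNorm z).trans (by rwa [hf, one_mul])
  have eq_one : ∀ w : 𝕜, ‖w‖ ≤ 1 → 1 ≤ RCLike.re w → w = 1 := by
    intro w hw hre
    have hre' : RCLike.re w = 1 := le_antisymm ((RCLike.re_le_norm w).trans hw) hre
    have hsq := RCLike.norm_sq_eq_def (z := w)
    have him : RCLike.im w = 0 := by nlinarith [norm_nonneg w, sq_nonneg (RCLike.im w)]
    exact RCLike.ext (by simp [hre']) (by simp [him])
  have hsum : t * RCLike.re (f z₁) + (1 - t) * RCLike.re (f z₂) = 1 := by
    have := congrArg (fun z ↦ RCLike.re (f z)) hxz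
    simp only [hfx, map_add, map_smul, smul_eq_mul, RCLike.re_ofReal_mul, RCLike.one_re] at this
    exact this.symm
  have hre₁ := (RCLike.re_le_norm (f z₁)).trans (hle z₁ h₁)
  have hre₂ := (RCLike.re_le_norm (f z₂)).trans (hle z₂ h₂)
  exact ⟨huniq z₁ h₁ (eq_one _ (hle z₁ h₁) (by nlinarith)),
    huniq z₂ h₂ (eq_one _ (hle z₂ h₂) (by nlinarith))⟩

theorem IsStrictlyConvexSpace.isExposedPointOfBall {𝕜 X : Type*} [RCLike 𝕜]
    [NormedAddCommGroup X] [NormedSpace 𝕜 X] (h : IsStrictlyConvexSpace 𝕜 X) {x : X}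
    (hx : ‖x‖ = 1) : IsExposedPointOfBall 𝕜 x := by
  obtain ⟨f, hf, hfx⟩ := exists_dual_vector 𝕜 x (by simp [hx])
  have hfx' : f x = 1 := by simp [hfx, hx]
  refine ⟨hx.le, f, hf, hfx', fun z hz hfz ↦ ?_⟩
  set m : X := ((1 / 2 : ℝ) : 𝕜) • z + ((1 - 1 / 2 : ℝ) : 𝕜) • x with hm
  have hfm : f m = 1 := by
    simp only [hm, map_add, map_smul, hfz, hfx', smul_eq_mul, mul_one]
    rw [← RCLike.ofReal_add]
    norm_num
  have hm_ge : 1 ≤ ‖m‖ := by simpa [hfm, hf] using f.le_opNorm m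
  have hm_le : ‖m‖ ≤ 1 := by
    refine (norm_add_le _ _).trans ?_
    rw [norm_smul, norm_smul, RCLike.norm_ofReal, RCLike.norm_ofReal, hx]
    norm_num
    linarith
  obtain ⟨hzm, hxm⟩ := (h m (le_antisymm hm_le hm_ge)).2 z x hz hx.le (1 / 2)
    (by norm_num) (by norm_num) hm
  exact hzm.trans hxm.symm

theorem IsStronglyOrthonormalRelTo.norm_lt_norm_add {𝕜 X : Type*} [RCLike 𝕜]
    [NormedAddCommGroup X] [NormedSpace 𝕜 X] {B : Set X} {x h : X}
    (hB : IsStronglyOrthonormalRelTo 𝕜 B x) (hh : h ∈ Submodule.span 𝕜 (B \ {x}))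
    (hne : h ≠ 0) : ‖x‖ < ‖x + h‖ := by
  obtain ⟨c, s, hs, -, rfl⟩ := Submodule.mem_span_iff_exists_finset_subset.1 hh
  refine hB.2 s c hs ?_
  by_contra! hc
  exact hne (Finset.sum_eq_zero fun y hy ↦ by rw [hc y hy, zero_smul])

theorem IsHamelBasis.isExposedPointOfBall {𝕜 X : Type*} [RCLike 𝕜]
    [NormedAddCommGroup X] [NormedSpace 𝕜 X] {B : Set X} {x : X} (hB : IsHamelBasis 𝕜 B)
    (hxB : x ∈ B) (hBx : IsStronglyOrthonormalRelTo 𝕜 B x) : IsExposedPointOfBall 𝕜 x := by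
  have hx : ‖x‖ = 1 := hBx.1 x hxB
  let b := Module.Basis.mk hB.1 (by simp [hB.2])
  let g : X →ₗ[𝕜] 𝕜 := b.coord ⟨x, hxB⟩
  have hgx : g x = 1 := by
    have := b.repr_self ⟨x, hxB⟩
    simp only [b, Module.Basis.mk_apply] at this
    simp [g, b, this]
  have hgker : ∀ h ∈ Submodule.span 𝕜 (B \ {x}), g h = 0 := by
    intro h hh
    refine (Submodule.span_le (p := LinearMap.ker g)).2 (fun y hy ↦ ?_) hh
    have := b.repr_self ⟨y, hy.1⟩
    simp only [b, Module.Basis.mk_apply] at this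
    have hyx : y ≠ x := hy.2
    simp [g, b, this, hyx]
  have hdecomp : ∀ z : X, ∃ h ∈ Submodule.span 𝕜 (B \ {x}), z = g z • x + h := by
    intro z
    have hz : z ∈ Submodule.span 𝕜 (insert x (B \ {x})) := by
      simp [Set.insert_eq_of_mem hxB, hB.2]
    obtain ⟨a, h, hh, rfl⟩ := Submodule.mem_span_insert.1 hz
    exact ⟨h, hh, by simp [hgx, hgker h hh]⟩
  have hlt : ∀ h ∈ Submodule.span 𝕜 (B \ {x}), h ≠ 0 → 1 < ‖x + h‖ := fun h hh hne ↦
    hx ▸ hBx.norm_lt_norm_add hh hne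
  have hbound : ∀ z : X, ‖g z‖ ≤ 1 * ‖z‖ := by
    intro z
    obtain ⟨h, hh, hz⟩ := hdecomp z
    rcases eq_or_ne (g z) 0 with ha | ha
    · simp [ha]
    have hge : 1 ≤ ‖x + (g z)⁻¹ • h‖ := by
      rcases eq_or_ne ((g z)⁻¹ • h) 0 with h0 | h0
      · simp [h0, hx]
      · exact (hlt _ (Submodule.smul_mem _ _ hh) h0).le
    have hnorm : ‖z‖ = ‖g z‖ * ‖x + (g z)⁻¹ • h‖ := by
      rw [← norm_smul, smul_add, smul_inv_smul₀ ha, ← hz]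
    rw [one_mul, hnorm]
    exact le_mul_of_one_le_right (norm_nonneg _) hge
  let f : X →L[𝕜] 𝕜 := g.mkContinuous 1 hbound
  have hfx : f x = 1 := hgx
  refine ⟨hx.le, f, le_antisymm (g.mkContinuous_norm_le zero_le_one hbound) ?_, hfx, ?_⟩
  · simpa [hfx, hx] using f.le_opNorm x
  · intro z hz hfz
    obtain ⟨h, hh, hzh⟩ := hdecomp z
    rw [show g z = 1 from hfz, one_smul] at hzh
    by_contra hne
    refine (hlt h hh fun h0 ↦ hne (by rw [hzh, h0, add_zero])).not_ge ?_
    rwa [← hzh]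

theorem IsExposedPointOfBall.exists_isHamelBasis {𝕜 X : Type*} [RCLike 𝕜]
    [NormedAddCommGroup X] [NormedSpace 𝕜 X] {x : X} (h : IsExposedPointOfBall 𝕜 x)
    (hx : ‖x‖ = 1) :
    ∃ B : Set X, x ∈ B ∧ IsHamelBasis 𝕜 B ∧ IsStronglyOrthonormalRelTo 𝕜 B x := by
  obtain ⟨-, f, hf, hfx, huniq⟩ := h
  let K : Submodule 𝕜 X := LinearMap.ker (f : X →ₗ[𝕜] 𝕜)
  have hK : ∀ z, z ∈ K ↔ f z = 0 := fun z ↦ Iff.rfl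
  let b₀ := Module.Basis.ofVectorSpace 𝕜 K
  have hw : ∀ i, IsUnit ((‖b₀ i‖⁻¹ : ℝ) : 𝕜) := fun i ↦ by
    simpa using b₀.ne_zero i
  let b := b₀.isUnitSMul hw
  have hb : ∀ i, ‖b i‖ = 1 := fun i ↦ by
    rw [Module.Basis.isUnitSMul_apply, norm_smul, RCLike.norm_ofReal, abs_inv, abs_norm,
      inv_mul_cancel₀ (norm_ne_zero_iff.2 (b₀.ne_zero i))]
  let N : Set X := Set.range fun i ↦ (b i : X)
  have hspan : Submodule.span 𝕜 N = K := by
    have : N = K.subtype '' Set.range b := by rw [← Set.range_comp]; rfl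
    rw [this, ← Submodule.map_span, b.span_eq, Submodule.map_subtype_top]
  have hNli : LinearIndepOn 𝕜 id N :=
    (b.linearIndependent.map' K.subtype K.ker_subtype).linearIndepOn_id
  have hxK : x ∉ K := by simp [hK, hfx]
  have hli : LinearIndepOn 𝕜 id (insert x N) := hNli.id_insert (by rwa [hspan])
  refine ⟨insert x N, Set.mem_insert _ _, ⟨hli, ?_⟩, ?_, ?_⟩
  · refine (Submodule.eq_top_iff').2 fun z ↦ Submodule.mem_span_insert.2
      ⟨f z, z - f z • x, ?_, by abel⟩
    simp [hspan, hK, hfx]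
  · rintro y (rfl | ⟨i, rfl⟩)
    · exact hx
    · exact hb i
  · intro s c hs hc
    have hsN : (s : Set X) ⊆ N := fun y hy ↦ (hs hy).1.resolve_left (hs hy).2
    set v := ∑ y ∈ s, c y • y with hv
    have hvK : f v = 0 := (hK v).1 <| hspan ▸
      Submodule.sum_mem _ fun y hy ↦ Submodule.smul_mem _ _ (Submodule.subset_span (hsN hy))
    have hv0 : v ≠ 0 := fun h0 ↦ by
      obtain ⟨y, hy, hcy⟩ := hc
      exact hcy (linearIndepOn_finset_iff.1 (hNli.mono hsN) c h0 y hy)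
    rw [hx]
    by_contra! hle
    exact hv0 (add_eq_left.1 (huniq (x + v) hle (by simp [hfx, hvK])))

/-- A normed linear space is strictly convex iff for each unit vector `x` there exists a
Hamel basis of `X` containing `x` which is strongly orthonormal relative to `x` in the
sense of Birkhoff–James. -/
theorem strictlyConvex_iff_stronglyOrthonormalBasis
    (𝕜 X : Type*) [RCLike 𝕜] [NormedAddCommGroup X] [NormedSpace 𝕜 X] :
    IsStrictlyConvexSpace 𝕜 X ↔
      ∀ x : X, ‖x‖ = 1 →
        ∃ B : Set X, x ∈ B ∧ IsHamelBasis 𝕜 B ∧ IsStronglyOrthonormalRelTo 𝕜 B x := by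
  exact ⟨fun h x hx ↦ (h.isExposedPointOfBall hx).exists_isHamelBasis hx, fun h x hx ↦
    let ⟨_, hxB, hB, hBx⟩ := h x hx
    (hB.isExposedPointOfBall hxB hBx).isExtremePointOfBall⟩
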